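/- arXiv:math/0303012 — 5 statements merged into one kernel-verified Lean document; each statement's English description precedes it below -/
import Mathlib

section
/- Let n ≥ 1 and let S ⊆ ℤⁿ have the line property. If S ≠ ℤⁿ, then the density |S ∩ [−k,k]ⁿ| / (2k+1)ⁿ tends to 0 as k → ∞. -/
open Filter

/-- A set of words with the line property over a finite alphabet is either everything or has at
most `n * |α| ^ (n - 1)` elements. -/
theorem card_mul_card_le_of_line_property {α : Type*} [Fintype α] [DecidableEq α] (n : ℕ)
    (S : Finset (Fin n → α))
    (hS : ∀ (x : Fin n → α) (j : Fin n) (a b : α), a ≠ b →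
      Function.update x j a ∈ S → Function.update x j b ∈ S →
      ∀ t : α, Function.update x j t ∈ S)
    (hne : S ≠ Finset.univ) :
    Fintype.card α * S.card ≤ n * Fintype.card α ^ n := by
  induction n with
  | zero =>
    have h := (Finset.card_lt_iff_ne_univ S).2 hne
    simp only [Fintype.card_pi, Finset.univ_eq_empty, Finset.prod_empty, Nat.lt_one_iff] at h
    simp [h]
  | succ n ih =>
    set m := Fintype.card α with hm
    let slice : α → Finset (Fin n → α) := fun t => Finset.univ.filter fun y => Fin.cons t y ∈ S
    have mem_slice (t : α) (y : Fin n → α) : y ∈ slice t ↔ (Fin.cons t y : Fin (n + 1) → α) ∈ S := by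
      simp [slice]
    have card_eq : S.card = ∑ t, (slice t).card := by
      have h : S.card = ∑ f : Fin (n + 1) → α, if f ∈ S then 1 else 0 := by simp
      rw [h, ← (Fin.consEquiv fun _ : Fin (n + 1) => α).sum_comp, Fintype.sum_prod_type]
      refine Finset.sum_congr rfl fun t _ => ?_
      rw [Finset.card_filter]
      rfl
    have slice_bound (t : α) : m * (slice t).card ≤
        (if slice t = Finset.univ then m ^ (n + 1) else 0) + n * m ^ n := by
      split_ifs with h
      · have : (slice t).card = m ^ n := by rw [h]; simp [hm]
        rw [this, pow_succ']
        exact Nat.le_add_right _ _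
      · rw [zero_add]
        refine ih (slice t) (fun x j a b hab ha hb s => ?_) h
        rw [mem_slice, Fin.cons_update] at *
        exact hS _ _ a b hab ha hb s
    have full_le_one : (Finset.univ.filter fun t => slice t = Finset.univ).card ≤ 1 := by
      refine Finset.card_le_one.2 fun a ha b hb => ?_
      by_contra hab
      simp only [Finset.mem_filter, Finset.mem_univ, true_and] at ha hb
      refine hne (Finset.eq_univ_iff_forall.2 fun f => ?_)
      have key (c : α) (hc : slice c = Finset.univ) : Function.update f 0 c ∈ S := by
        have h := (mem_slice c (Fin.tail f)).1 (hc ▸ Finset.mem_univ _)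
        rwa [← Fin.cons_self_tail f, Fin.update_cons_zero]
      simpa using hS f 0 a b hab (key a ha) (key b hb) (f 0)
    calc m * S.card = ∑ t, m * (slice t).card := by rw [card_eq, Finset.mul_sum]
      _ ≤ ∑ t, ((if slice t = Finset.univ then m ^ (n + 1) else 0) + n * m ^ n) :=
          Finset.sum_le_sum fun t _ => slice_bound t
      _ = (Finset.univ.filter fun t => slice t = Finset.univ).card * m ^ (n + 1)
            + m * (n * m ^ n) := by
          rw [Finset.sum_add_distrib, ← Finset.sum_filter]
          simp [hm]
      _ ≤ 1 * m ^ (n + 1) + m * (n * m ^ n) := by gcongr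
      _ = (n + 1) * m ^ (n + 1) := by ring

/-- A set with the line property that misses a point of the box `[−k, k]ⁿ` has at most
`n (2k+1)ⁿ⁻¹` points in that box. -/
theorem ncard_inter_box_le_of_line_property (n k : ℕ) (S : Set (Fin n → ℤ))
    (hS : ∀ (x : Fin n → ℤ) (j : Fin n) (a b : ℤ), a ≠ b →
      Function.update x j a ∈ S → Function.update x j b ∈ S →
      ∀ t : ℤ, Function.update x j t ∈ S)
    (p : Fin n → ℤ) (hp : p ∉ S) (hpk : ∀ i, |p i| ≤ (k : ℤ)) :
    (2 * k + 1) * (S ∩ {x : Fin n → ℤ | ∀ i, |x i| ≤ (k : ℤ)}).ncard ≤ n * (2 * k + 1) ^ n := by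
  classical
  let α := Finset.Icc (-(k : ℤ)) k
  let ι : (Fin n → α) → (Fin n → ℤ) := fun f i => (f i : ℤ)
  have hι : Function.Injective ι := fun f g h => funext fun i => Subtype.ext (congrFun h i)
  have hupd (x : Fin n → α) (j : Fin n) (a : α) :
      ι (Function.update x j a) = Function.update (ι x) j (a : ℤ) := by
    funext i
    by_cases h : i = j
    · subst h; simp [ι]
    · simp [ι, h]
  have hcard : Fintype.card α = 2 * k + 1 := by
    simp only [α, Fintype.card_coe, Int.card_Icc]
    omega
  let T : Finset (Fin n → α) := Finset.univ.filter fun f => ι f ∈ S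
  have himage : S ∩ {x : Fin n → ℤ | ∀ i, |x i| ≤ (k : ℤ)} = ι '' (T : Set (Fin n → α)) := by
    ext x
    constructor
    · rintro ⟨hx, hxk⟩
      exact ⟨fun i => ⟨x i, Finset.mem_Icc.2 (abs_le.1 (hxk i))⟩, by simpa [T, ι] using hx, rfl⟩
    · rintro ⟨f, hf, rfl⟩
      exact ⟨by simpa [T] using hf, fun i => abs_le.2 (Finset.mem_Icc.1 (f i).2)⟩
  rw [himage, Set.ncard_image_of_injective _ hι, Set.ncard_coe_finset, ← hcard]
  refine card_mul_card_le_of_line_property n T (fun x j a b hab ha hb t => ?_) fun h => ?_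
  · simp only [T, Finset.mem_filter, Finset.mem_univ, true_and, hupd] at *
    exact hS _ _ a b (fun h => hab (Subtype.ext h)) ha hb t
  · have hmem : (fun i => ⟨p i, Finset.mem_Icc.2 (abs_le.1 (hpk i))⟩ : Fin n → α) ∈ T :=
      h ▸ Finset.mem_univ _
    exact hp (Finset.mem_filter.1 hmem).2

/-- Let `n ≥ 1` and let `S ⊆ ℤⁿ` have the line property. If `S ≠ ℤⁿ`, then the
density `|S ∩ [−k,k]ⁿ| / (2k+1)ⁿ` tends to `0` as `k → ∞`. -/
theorem statement2 (n : ℕ) (hn : 1 ≤ n) (S : Set (Fin n → ℤ))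
    (hS : ∀ (x : Fin n → ℤ) (j : Fin n) (a b : ℤ), a ≠ b →
      Function.update x j a ∈ S → Function.update x j b ∈ S →
      ∀ t : ℤ, Function.update x j t ∈ S)
    (hne : S ≠ Set.univ) :
    Tendsto (fun k : ℕ =>
        ((S ∩ {x : Fin n → ℤ | ∀ i, |x i| ≤ (k : ℤ)}).ncard : ℝ) / (2 * (k : ℝ) + 1) ^ n)
      atTop (nhds 0) := by
  obtain ⟨p, hp⟩ := (Set.ne_univ_iff_exists_notMem S).1 hne
  have hlim : Tendsto (fun k : ℕ => (n : ℝ) / (2 * (k : ℝ) + 1)) atTop (nhds 0) :=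
    tendsto_const_nhds.div_atTop <| tendsto_atTop_add_const_right _ _ <|
      tendsto_natCast_atTop_atTop.const_mul_atTop two_pos
  refine tendsto_of_tendsto_of_tendsto_of_le_of_le' tendsto_const_nhds hlim
    (Eventually.of_forall fun k => by positivity) ?_
  have hbox : ∀ᶠ k : ℕ in atTop, ∀ i, |p i| ≤ (k : ℤ) :=
    eventually_all.2 fun i => tendsto_natCast_atTop_atTop.eventually_ge_atTop |p i|
  filter_upwards [hbox] with k hk
  have h := ncard_inter_box_le_of_line_property n k S hS p hp hk
  rw [div_le_div_iff₀ (by positivity) (by positivity), mul_comm]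
  exact_mod_cast h
end

section
/- Let R be a commutative ring, z, A∞ ∈ R, and let A : ℤ → R be a twist sequence for (z, A∞). Then for every n ∈ ℤ and every natural number k: ∑_{i=0}^{k} C(k,i)·A(n−2i) = z^k·A(n−k) + z·(∑_{j=0}^{k−1} z^j·2^{k−1−j})·A∞, where C(k,i) denotes the binomial coefficient. -/
/-- Let `R` be a commutative ring, `z, A∞ ∈ R`, and let `A : ℤ → R` be a twist
sequence for `(z, A∞)`. Then for every `n ∈ ℤ` and every `k ∈ ℕ`:
`∑_{i=0}^{k} C(k,i)·A(n−2i) = z^k·A(n−k) + z·(∑_{j=0}^{k−1} z^j·2^{k−1−j})·A∞`. -/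
theorem statement4 (R : Type*) [CommRing R] (z Ainf : R) (A : ℤ → R)
    (hA : ∀ n : ℤ, A n + A (n - 2) = z * (A (n - 1) + Ainf)) :
    ∀ (n : ℤ) (k : ℕ),
      ∑ i ∈ Finset.range (k + 1), (Nat.choose k i : R) * A (n - 2 * (i : ℤ)) =
        z ^ k * A (n - (k : ℤ)) +
          z * (∑ j ∈ Finset.range k, z ^ j * (2 : R) ^ (k - 1 - j)) * Ainf := by
  intro n k
  induction k generalizing n with
  | zero => simp
  | succ k ih =>
    have pascal := Finset.sum_choose_succ_mul (fun i _ => A (n - 2 * (i : ℤ))) k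
    have shift : ∀ i : ℕ, A (n - 2 * ((i + 1 : ℕ) : ℤ)) = A (n - 2 - 2 * (i : ℤ)) :=
      fun i => congrArg A (by push_cast; ring)
    simp only [shift] at pascal
    have twist := hA (n - k)
    rw [show n - (k : ℤ) - 2 = n - 2 - k by ring,
      show n - (k : ℤ) - 1 = n - ((k + 1 : ℕ) : ℤ) by push_cast; ring] at twist
    have geom := (Commute.all z 2).geom_sum₂_succ_eq (n := k)
    rw [pascal, ih n, ih (n - 2), Nat.add_sub_cancel, geom]
    linear_combination z ^ k * twist
end

section
/- Let k be a prime number, let ℤ[z] be the polynomial ring over ℤ with indeterminate z, let A∞ ∈ ℤ[z], and let A : ℤ → ℤ[z] be a twist sequence for (z, A∞). Then for every n ∈ ℤ, the difference A(n) − A(n−4k) lies in the ideal of ℤ[z] generated by the constant k and by z^k. (In other words, the residue of A(n) modulo (k, z^k) is periodic in n with period 4k.) -/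
open Polynomial in
theorem twist_polynomial_dvd {R : Type*} [CommRing R] {k : ℕ} (hk : k.Prime) {z : R}
    (hkR : (k : R) = 0) (hz : z ^ k = 0) :
    (X - 1) * (X ^ 2 + 1 - C z * X) ∣ (X ^ (4 * k) - 1 : R[X]) := by
  have hkX : (k : R[X]) = 0 := by
    rw [← map_natCast (C : R →+* R[X]), hkR, map_zero]
  obtain ⟨r, hr⟩ := exists_add_pow_prime_eq hk (X ^ 2 + 1 : R[X]) (-C z * X)
  obtain ⟨s, hs⟩ := exists_add_pow_prime_eq hk (X ^ 2 : R[X]) 1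
  have hzX : (-C z * X : R[X]) ^ k = 0 := by
    rw [mul_pow, neg_pow, ← map_pow, hz]
    simp
  have hpow : (X ^ 2 + 1 - C z * X : R[X]) ^ k = X ^ (2 * k) + 1 := by
    rw [show (X ^ 2 + 1 - C z * X : R[X]) = X ^ 2 + 1 + -C z * X by ring, hr, hs, hzX, hkX,
      one_pow, ← pow_mul]
    ring
  have hfactor : (X ^ (4 * k) - 1 : R[X]) =
      (X ^ (2 * k) - 1) * (X ^ 2 + 1 - C z * X) ^ k := by
    rw [hpow]
    ring
  rw [hfactor]
  exact mul_dvd_mul (sub_one_dvd_pow_sub_one X (2 * k)) (dvd_pow_self _ hk.ne_zero)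

open Polynomial in
theorem twist_sequence_periodic {R : Type*} [CommRing R] {k : ℕ} (hk : k.Prime) {z : R}
    (hkR : (k : R) = 0) (hz : z ^ k = 0) {b : R} {B : ℤ → R}
    (hB : ∀ n : ℤ, B n + B (n - 2) = z * (B (n - 1) + b)) (n : ℤ) :
    B (n - 4 * (k : ℤ)) = B n := by
  let S : (ℤ → R) →ₗ[R] (ℤ → R) := LinearMap.funLeft R R (fun n => n - 1)
  have hS : ∀ (F : ℤ → R) (n : ℤ), S F n = F (n - 1) := fun _ _ => rfl
  have hSpow : ∀ (m : ℕ) (F : ℤ → R) (n : ℤ), (S ^ m) F n = F (n - m) := by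
    intro m
    induction m with
    | zero => simp
    | succ m ih =>
      intro F n
      rw [pow_succ, Module.End.mul_apply, ih, hS]
      congr 1
      push_cast
      ring
  have hP : aeval S (X ^ 2 + 1 - C z * X) B = fun _ => z * b := by
    funext n
    have h : B n + B (n - 2) - z * B (n - 1) = z * b := by rw [hB]; ring
    simp [hSpow, hS, ← h, Module.algebraMap_end_apply]
    ring
  have hkill : aeval S ((X - 1) * (X ^ 2 + 1 - C z * X)) B = 0 := by
    rw [map_mul, Module.End.mul_apply, hP]
    funext n
    simp [hS]
  obtain ⟨q, hq⟩ := twist_polynomial_dvd hk hkR hz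
  have h : aeval S (X ^ (4 * k) - 1 : R[X]) B = 0 := by
    rw [hq, mul_comm, map_mul, Module.End.mul_apply, hkill, map_zero]
  have hn := congrFun h n
  simp [hSpow] at hn
  exact sub_eq_zero.mp hn


/-- Let `k` be a prime, let `ℤ[z]` be the integer polynomial ring, `A∞ ∈ ℤ[z]`,
and let `A : ℤ → ℤ[z]` be a twist sequence for `(z, A∞)` (where `z` is the indeterminate
`Polynomial.X`). Then for every `n ∈ ℤ`, `A(n) − A(n−4k)` lies in the ideal of `ℤ[z]`
generated by the constant `k` and by `z^k`. -/
theorem statement5 (k : ℕ) (hk : Nat.Prime k) (Ainf : Polynomial ℤ) (A : ℤ → Polynomial ℤ)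
    (hA : ∀ n : ℤ, A n + A (n - 2) = Polynomial.X * (A (n - 1) + Ainf)) :
    ∀ n : ℤ, A n - A (n - 4 * (k : ℤ)) ∈
      Ideal.span ({(k : Polynomial ℤ), Polynomial.X ^ k} : Set (Polynomial ℤ)) := by
  intro n
  set I := Ideal.span ({(k : Polynomial ℤ), Polynomial.X ^ k} : Set (Polynomial ℤ)) with hI
  let π := Ideal.Quotient.mk I
  have hkI : ((k : ℕ) : Polynomial ℤ ⧸ I) = 0 := by
    rw [← map_natCast π]
    exact Ideal.Quotient.eq_zero_iff_mem.mpr (Ideal.subset_span (by simp))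
  have hXI : π Polynomial.X ^ k = 0 := by
    rw [← map_pow]
    exact Ideal.Quotient.eq_zero_iff_mem.mpr (Ideal.subset_span (by simp))
  have hπ : ∀ n : ℤ, π (A n) + π (A (n - 2)) = π Polynomial.X * (π (A (n - 1)) + π Ainf) := by
    intro n
    rw [← map_add, hA, map_mul, map_add]
  exact Ideal.Quotient.eq.mp
    (twist_sequence_periodic (B := fun n => π (A n)) hk hkI hXI hπ n).symm
end

section
/- Fix integers k ≥ 2 and l with 1 ≤ l ≤ k−1 and 2l ≠ k, and set z = 2·cos(πl/k) ∈ ℂ. Let B : ℕ → ℂ satisfy B(n+3) = (z² − 1)·(B(n+2) − B(n+1)) + B(n) for every n ∈ ℕ. Then B is periodic with period k: B(n+k) = B(n) for every n ∈ ℕ. -/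
/-- A solution of a third-order linear recurrence with characteristic roots `a`, `b`, `c` is
geometric with ratio `a` after applying the factor of the characteristic polynomial with roots
`b`, `c`. In particular, this factor is `k`-periodic when `a ^ k = 1`. -/
theorem quadratic_factor_periodic {R : Type*} [CommRing R] {a b c : R} {k : ℕ} (ha : a ^ k = 1)
    {B : ℕ → R}
    (hB : ∀ n, B (n + 3) =
      (a + b + c) * B (n + 2) - (a * b + b * c + c * a) * B (n + 1) + a * b * c * B n) (n : ℕ) :
    B (n + k + 2) - (b + c) * B (n + k + 1) + b * c * B (n + k) =
      B (n + 2) - (b + c) * B (n + 1) + b * c * B n := by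
  have key : ∀ m, B (n + m + 2) - (b + c) * B (n + m + 1) + b * c * B (n + m) =
      a ^ m * (B (n + 2) - (b + c) * B (n + 1) + b * c * B n) := by
    intro m
    induction m with
    | zero => simp
    | succ m ih =>
      have h := hB (n + m)
      rw [show n + (m + 1) + 2 = n + m + 3 by ring, show n + (m + 1) + 1 = n + m + 2 by ring,
        show n + (m + 1) = n + m + 1 by ring]
      linear_combination h + a * ih
  rw [key k, ha, one_mul]

/-- A solution of a third-order linear recurrence whose characteristic roots are distinct
`k`-th roots of unity is `k`-periodic. -/
theorem periodic_of_distinct_roots_of_unity {R : Type*} [CommRing R] [IsDomain R] {a b c : R}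
    {k : ℕ} (ha : a ^ k = 1) (hb : b ^ k = 1) (hc : c ^ k = 1)
    (hab : a ≠ b) (hbc : b ≠ c) (hca : c ≠ a) {B : ℕ → R}
    (hB : ∀ n, B (n + 3) =
      (a + b + c) * B (n + 2) - (a * b + b * c + c * a) * B (n + 1) + a * b * c * B n) (n : ℕ) :
    B (n + k) = B n := by
  have h1 := quadratic_factor_periodic ha hB n
  have h2 := quadratic_factor_periodic (a := b) (b := c) (c := a) (B := B) hb
    (fun n => by rw [hB n]; ring) n
  have h3 := quadratic_factor_periodic (a := c) (b := a) (c := b) (B := B) hc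
    (fun n => by rw [hB n]; ring) n
  have h12 : B (n + k + 1) - B (n + 1) = c * (B (n + k) - B n) :=
    mul_left_cancel₀ (sub_ne_zero.2 hab) (by linear_combination h1 - h2)
  have h23 : B (n + k + 1) - B (n + 1) = a * (B (n + k) - B n) :=
    mul_left_cancel₀ (sub_ne_zero.2 hbc) (by linear_combination h2 - h3)
  have h : (c - a) * (B (n + k) - B n) = 0 := by linear_combination h23 - h12
  exact sub_eq_zero.1 ((mul_eq_zero.1 h).resolve_left (sub_ne_zero.2 hca))

/-- Fix integers `k ≥ 2` and `l` with `1 ≤ l ≤ k−1` and `2l ≠ k`, and set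
`z = 2·cos(πl/k) ∈ ℂ`. If `B : ℕ → ℂ` satisfies
`B(n+3) = (z² − 1)·(B(n+2) − B(n+1)) + B(n)` for all `n`, then `B` is periodic with period
`k`: `B(n+k) = B(n)` for all `n`. -/
theorem statement6 (k l : ℕ) (hk : 2 ≤ k) (hl1 : 1 ≤ l) (hl2 : l ≤ k - 1) (hlk : 2 * l ≠ k)
    (z : ℂ) (hz : z = 2 * Complex.cos (Real.pi * l / k))
    (B : ℕ → ℂ)
    (hB : ∀ n : ℕ, B (n + 3) = (z ^ 2 - 1) * (B (n + 2) - B (n + 1)) + B n) :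
    ∀ n : ℕ, B (n + k) = B n := by
  have hk0 : k ≠ 0 := by omega
  have hζ := Complex.isPrimitiveRoot_exp k hk0
  set ζ := Complex.exp (2 * Real.pi * Complex.I / k) with hζ_def
  have hw0 : ζ ^ l ≠ 0 := pow_ne_zero _ (Complex.exp_ne_zero _)
  have hwk : (ζ ^ l) ^ k = 1 := by rw [← pow_mul, mul_comm, pow_mul, hζ.pow_eq_one, one_pow]
  have hw1 : ζ ^ l ≠ 1 := fun h => by
    have := Nat.le_of_dvd (by omega) (hζ.dvd_of_pow_eq_one l h)
    omega
  have hw2 : ζ ^ l ≠ (ζ ^ l)⁻¹ := fun h => by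
    have h' : ζ ^ (2 * l) = 1 := by
      rw [two_mul, pow_add]
      nth_rewrite 2 [h]
      exact mul_inv_cancel₀ hw0
    obtain ⟨m, hm⟩ := hζ.dvd_of_pow_eq_one _ h'
    have hm2 : m < 2 := by
      by_contra! hm2
      have := Nat.mul_le_mul_left k hm2
      omega
    interval_cases m <;> omega
  have hz2 : z ^ 2 - 1 = 1 + ζ ^ l + (ζ ^ l)⁻¹ := by
    have hexp : ζ ^ l = Complex.exp (Real.pi * l / k * Complex.I) ^ 2 := by
      rw [hζ_def, ← Complex.exp_nat_mul, ← Complex.exp_nat_mul]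
      congr 1
      push_cast
      ring
    rw [hz, hexp, Complex.two_cos, neg_mul, Complex.exp_neg]
    have := Complex.exp_ne_zero (Real.pi * l / k * Complex.I)
    field_simp
    ring
  refine periodic_of_distinct_roots_of_unity (one_pow k) hwk (by rw [inv_pow, hwk, inv_one])
    hw1.symm hw2 (inv_ne_one.2 hw1) fun n => ?_
  rw [hB n, hz2]
  linear_combination (B (n + 1) - B n) * mul_inv_cancel₀ hw0
end

section
/- For every complex number ξ with |ξ| = 1 there exists a positive integer k not divisible by 3 such that |1 + ξ^k| ≥ 1. Moreover this bound is optimal: if ξ = e^{2πi/3} is a primitive cube root of unity, then |1 + ξ^k| = 1 for every positive integer k not divisible by 3. -/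
open Complex

lemma one_le_norm_one_add_or_one_add_sq {z : ℂ} (hz : ‖z‖ = 1) :
    1 ≤ ‖1 + z‖ ∨ 1 ≤ ‖1 + z ^ 2‖ := by
  have hz' : z.re * z.re + z.im * z.im = 1 := by
    rw [← normSq_apply, normSq_eq_norm_sq, hz, one_pow]
  have h₁ : ‖1 + z‖ ^ 2 = 2 + 2 * z.re := by
    rw [← normSq_eq_norm_sq, normSq_apply]
    simp only [add_re, add_im, one_re, one_im]
    linear_combination hz'
  have h₂ : ‖1 + z ^ 2‖ ^ 2 = 4 * z.re ^ 2 := by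
    rw [← normSq_eq_norm_sq, normSq_apply]
    simp only [add_re, add_im, one_re, one_im, sq, mul_re, mul_im]
    linear_combination (z.re * z.re + z.im * z.im - 1) * hz'
  by_contra! h
  have h₃ := pow_lt_one₀ (norm_nonneg _) h.1 two_ne_zero
  have h₄ := pow_lt_one₀ (norm_nonneg _) h.2 two_ne_zero
  nlinarith

lemma norm_one_add_eq_one_of_pow_three_eq_one {z : ℂ} (hz : z ^ 3 = 1) (hz₁ : z ≠ 1) :
    ‖1 + z‖ = 1 := by
  have h : 1 + z = -z ^ 2 := by
    apply mul_left_cancel₀ (sub_ne_zero.mpr hz₁)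
    linear_combination hz
  rw [h, norm_neg, norm_pow, norm_eq_one_of_pow_eq_one hz three_ne_zero, one_pow]

/-- For every `ξ ∈ ℂ` with `|ξ| = 1` there is a positive integer `k` not
divisible by `3` with `|1 + ξ^k| ≥ 1`; moreover, for `ξ = e^{2πi/3}` a primitive cube root
of unity, `|1 + ξ^k| = 1` for every positive integer `k` not divisible by `3`. -/
theorem statement12 :
    (∀ ξ : ℂ, ‖ξ‖ = 1 → ∃ k : ℕ, 0 < k ∧ ¬ (3 ∣ k) ∧ 1 ≤ ‖1 + ξ ^ k‖) ∧
    (∀ k : ℕ, 0 < k → ¬ (3 ∣ k) →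
      ‖1 + (Complex.exp (2 * Real.pi * Complex.I / 3)) ^ k‖ = 1) := by
  constructor
  · intro ξ hξ
    rcases one_le_norm_one_add_or_one_add_sq hξ with h | h
    · exact ⟨1, by norm_num, by norm_num, by rwa [pow_one]⟩
    · exact ⟨2, by norm_num, by norm_num, h⟩
  · intro k _ hk
    have hω : IsPrimitiveRoot (exp (2 * Real.pi * I / 3)) 3 := by
      exact_mod_cast isPrimitiveRoot_exp 3 three_ne_zero
    apply norm_one_add_eq_one_of_pow_three_eq_one
    · rw [pow_right_comm, hω.pow_eq_one, one_pow]
    · rwa [Ne, hω.pow_eq_one_iff_dvd]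
end
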